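/- arXiv:2007.15253 — 3 statements merged into one kernel-verified Lean document; each statement's English description precedes it below -/
import Mathlib

section
/- Let q be a prime power, 1 ≤ m ≤ ℓ, and let F = F_{q^ℓ} with subfield F_q. Let α* ∈ F and suppose g_1, …, g_ℓ ∈ F[X] are polynomials, each of degree at most q^m − 1, such that g_1(α*), …, g_ℓ(α*) span F as an F_q-vector space. For each α ∈ F set b_α := dim_{F_q} span_{F_q}{g_1(α), …, g_ℓ(α)}. Then ∑_{α ∈ F \ {α*}} b_α ≥ (q^ℓ − 1)(ℓ − m). -/
open scoped Classical

lemma aux_tangent (q m x : ℕ) (hq : 2 ≤ q) :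
    (q : ℤ) ^ m + ((x : ℤ) - m) * ((q : ℤ) ^ m * (q - 1)) ≤ (q : ℤ) ^ x := by
  have hq' : (2 : ℤ) ≤ q := by exact_mod_cast hq
  rcases le_total m x with h | h
  · obtain ⟨k, rfl⟩ := Nat.exists_eq_add_of_le h
    have h1 : 1 + (k : ℤ) * ((q : ℤ) - 1) ≤ (1 + ((q : ℤ) - 1)) ^ k :=
      one_add_mul_le_pow (by linarith) k
    have h2 : (0 : ℤ) ≤ (q : ℤ) ^ m := by positivity
    have h3 := mul_le_mul_of_nonneg_left h1 h2
    rw [pow_add]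
    push_cast
    have h4 : (1 + ((q : ℤ) - 1)) = q := by ring
    rw [h4] at h3
    linarith
  · rcases h.eq_or_lt with rfl | h
    · simp
    · have h2 : (0 : ℤ) < (q : ℤ) ^ m := by positivity
      have h3 : (0 : ℤ) < (q : ℤ) ^ x := by positivity
      have h4 : (x : ℤ) + 1 ≤ m := by exact_mod_cast h
      have h5 : (q : ℤ) ^ m ≤ (q : ℤ) ^ m * (q - 1) := by nlinarith
      nlinarith

/-- Lower bound for a full-length Reed–Solomon code with `n = q^ℓ` and `r = q^m`:
for any linear repair scheme given by `ℓ` check polynomials of degree at most `q^m − 1`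
whose evaluations at `α*` span `F_{q^ℓ}` over `F_q`, the total bandwidth
`∑_{α ≠ α*} b_α` is at least `(q^ℓ − 1)(ℓ − m)`. -/
theorem statement2 {K F : Type*} [Field K] [Field F] [Fintype K] [Fintype F] [Algebra K F]
    (q ℓ m : ℕ) (hq : Fintype.card K = q) (hℓ : Module.finrank K F = ℓ)
    (hm1 : 1 ≤ m) (hmℓ : m ≤ ℓ)
    (αs : F) (g : Fin ℓ → Polynomial F) (hdeg : ∀ i, (g i).natDegree ≤ q ^ m - 1)
    (hspan : Submodule.span K (Set.range fun i => (g i).eval αs) = ⊤)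
    (b : F → ℕ)
    (hb : ∀ α : F, b α = Module.finrank K
      (Submodule.span K (Set.range fun i => (g i).eval α))) :
    (q ^ ℓ - 1) * (ℓ - m) ≤ ∑ α ∈ Finset.univ.erase αs, b α := by
  have hq2 : 2 ≤ q := hq ▸ Fintype.one_lt_card
  have hFcard : Fintype.card F = q ^ ℓ := by
    rw [Module.card_eq_pow_finrank (K := K) (V := F), hq, hℓ]
  let φ : F → ((Fin ℓ → K) →ₗ[K] F) := fun α =>
    Fintype.linearCombination K (fun i => (g i).eval α)
  have hrange : ∀ α, Module.finrank K (LinearMap.range (φ α)) = b α := by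
    intro α
    rw [hb, Fintype.range_linearCombination]
  have hrk : ∀ α, b α + Module.finrank K (LinearMap.ker (φ α)) = ℓ := by
    intro α
    have := LinearMap.finrank_range_add_finrank_ker (φ α)
    rw [hrange] at this
    simpa using this
  have hker : ∀ α, (Finset.univ.filter (fun c => φ α c = 0)).card
      = q ^ (Module.finrank K (LinearMap.ker (φ α))) := by
    intro α
    rw [← hq, ← Module.card_eq_pow_finrank (K := K) (V := LinearMap.ker (φ α)),
      Fintype.card_subtype]
    simp [LinearMap.mem_ker]
  have hinj : ∀ c, φ αs c = 0 → c = 0 := by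
    have h1 : b αs = ℓ := by rw [hb, hspan, finrank_top, hℓ]
    have h2 := hrk αs
    have h3 : Module.finrank K (LinearMap.ker (φ αs)) = 0 := by omega
    have h4 : LinearMap.ker (φ αs) = ⊥ := Submodule.finrank_eq_zero.mp h3
    exact fun c hc => LinearMap.ker_eq_bot'.mp h4 c hc
  -- polynomial attached to c
  let P : (Fin ℓ → K) → Polynomial F := fun c =>
    ∑ i, Polynomial.C (algebraMap K F (c i)) * g i
  have hP : ∀ c α, (P c).eval α = φ α c := by
    intro c α
    simp [P, φ, Polynomial.eval_finset_sum, Fintype.linearCombination_apply, Algebra.smul_def]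
  have hPdeg : ∀ c, (P c).natDegree ≤ q ^ m - 1 := by
    intro c
    apply Polynomial.natDegree_sum_le_of_forall_le
    intro i _
    exact (Polynomial.natDegree_C_mul_le _ _).trans (hdeg i)
  set S := Finset.univ.erase αs with hS
  have hScard : S.card = q ^ ℓ - 1 := by
    rw [hS, Finset.card_erase_of_mem (Finset.mem_univ _), Finset.card_univ, hFcard]
  have hroots : ∀ c, c ≠ 0 → (S.filter (fun α => φ α c = 0)).card ≤ q ^ m - 1 := by
    intro c hc
    have hne : P c ≠ 0 := by
      intro h
      apply hc
      apply hinj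
      rw [← hP, h, Polynomial.eval_zero]
    refine le_trans ?_ (hPdeg c)
    refine le_trans ?_ (Polynomial.card_roots' (P c))
    refine le_trans (Finset.card_le_card ?_) (Multiset.toFinset_card_le _)
    intro α hα
    rw [Finset.mem_filter] at hα
    rw [Multiset.mem_toFinset, Polynomial.mem_roots hne, Polynomial.IsRoot.def, hP]
    exact hα.2
  have hcount : ∑ α ∈ S, q ^ (Module.finrank K (LinearMap.ker (φ α))) ≤
      (q ^ ℓ - 1) + (q ^ ℓ - 1) * (q ^ m - 1) := by
    calc _ = ∑ α ∈ S, (Finset.univ.filter (fun c => φ α c = 0)).card :=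
          Finset.sum_congr rfl (fun α _ => (hker α).symm)
      _ = ∑ c, (S.filter (fun α => φ α c = 0)).card := by
          simp only [Finset.card_filter]
          exact Finset.sum_comm
      _ = (S.filter (fun α => φ α 0 = 0)).card
          + ∑ c ∈ Finset.univ.erase 0, (S.filter (fun α => φ α c = 0)).card :=
          (Finset.add_sum_erase _ _ (Finset.mem_univ _)).symm
      _ ≤ _ := by
          refine add_le_add ?_ ?_
          · exact (Finset.card_filter_le _ _).trans hScard.le
          · refine (Finset.sum_le_card_nsmul _ _ (q ^ m - 1) ?_).trans ?_
            · intro c hc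
              exact hroots c (Finset.ne_of_mem_erase hc)
            · rw [Finset.card_erase_of_mem (Finset.mem_univ _), Finset.card_univ]
              simp [hq]
  have hqm : 1 ≤ q ^ m := Nat.one_le_pow _ _ (by omega)
  have hcount2 : ∑ α ∈ S, q ^ (Module.finrank K (LinearMap.ker (φ α))) ≤ S.card * q ^ m := by
    refine hcount.trans (le_of_eq ?_)
    rw [hScard]
    obtain ⟨t, ht⟩ := Nat.exists_eq_add_of_le hqm
    rw [ht, Nat.add_sub_cancel_left]
    ring
  have hT : ∑ α ∈ S, ((q : ℤ) ^ m + (((Module.finrank K (LinearMap.ker (φ α)) : ℕ) : ℤ) - m)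
      * ((q : ℤ) ^ m * (q - 1))) ≤ S.card * (q : ℤ) ^ m :=
    (Finset.sum_le_sum (fun α _ => aux_tangent q m _ hq2)).trans (by exact_mod_cast hcount2)
  rw [Finset.sum_add_distrib, ← Finset.sum_mul, Finset.sum_const, nsmul_eq_mul] at hT
  have hq' : (2 : ℤ) ≤ q := by exact_mod_cast hq2
  have hpos : (0 : ℤ) < (q : ℤ) ^ m * (q - 1) := mul_pos (by positivity) (by linarith)
  have hle : ∑ α ∈ S, (((Module.finrank K (LinearMap.ker (φ α)) : ℕ) : ℤ) - m) ≤ 0 := by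
    by_contra! h
    have := mul_pos h hpos
    linarith
  have hsum : ∑ α ∈ S, (((Module.finrank K (LinearMap.ker (φ α)) : ℕ) : ℤ) - m)
      = S.card * ((ℓ : ℤ) - m) - ∑ α ∈ S, (b α : ℤ) := by
    rw [← nsmul_eq_mul, ← Finset.sum_const, ← Finset.sum_sub_distrib]
    refine Finset.sum_congr rfl (fun α _ => ?_)
    have : (b α : ℤ) + (Module.finrank K (LinearMap.ker (φ α)) : ℕ) = ℓ := by
      exact_mod_cast hrk α
    linarith
  rw [hsum] at hle
  rw [← hScard]
  zify [hmℓ]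
  linarith
end

section
/- (Reduction Lemma) Let q be an even prime power (a power of 2), let ℓ be even, and let m be an integer with ℓ/2 + 1 ≤ m ≤ ℓ. Regard F_{q^{ℓ/2}} as a subfield of F_{q^ℓ}. If there exists an F_q-subspace U of F_{q^{ℓ/2}} of dimension m − ℓ/2 with τ_U ∈ F_q, then there exists an F_q-subspace W of F_{q^ℓ} of dimension m satisfying both τ_W ∈ F_q and L_W(L_W(α)) = 0 for all α ∈ F_{q^ℓ} (equivalently, the image of the map α ↦ L_W(α) is contained in W). -/
open scoped Classical

theorem aux_prod {F : Type*} [Field F] [Fintype F] [CharP F 2] (N : ℕ) (hN : 2 ≤ N)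
    (hc : (Finset.univ.filter (fun e : F => e ^ N + e = 0)).card = N) (x : F) :
    ∏ e ∈ Finset.univ.filter (fun e : F => e ^ N + e = 0), (x + e) = x ^ N + x := by
  set S := Finset.univ.filter (fun e : F => e ^ N + e = 0) with hS
  have key : (∏ e ∈ S, (Polynomial.X - Polynomial.C e) : Polynomial F)
      = Polynomial.X ^ N + Polynomial.X := by
    have hm1 : (∏ e ∈ S, (Polynomial.X - Polynomial.C e) : Polynomial F).Monic :=
      Polynomial.monic_prod_of_monic _ _ (fun e _ => Polynomial.monic_X_sub_C e)
    have hd1 : (∏ e ∈ S, (Polynomial.X - Polynomial.C e) : Polynomial F).degree = N := by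
      rw [Polynomial.degree_prod]; simp [hc]
    have hlt : (Polynomial.X : Polynomial F).degree < (N : WithBot ℕ) := by
      rw [Polynomial.degree_X]; exact_mod_cast hN
    have hm2 : (Polynomial.X ^ N + Polynomial.X : Polynomial F).Monic :=
      Polynomial.monic_X_pow_add hlt
    have hd2 : (Polynomial.X ^ N + Polynomial.X : Polynomial F).degree = N := by
      rw [Polynomial.degree_add_eq_left_of_degree_lt] <;> rw [Polynomial.degree_X_pow]
      exact hlt
    apply Polynomial.eq_of_degree_sub_lt_of_eval_finset_eq S
    · rw [hc, ← hd1]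
      apply Polynomial.degree_sub_lt (hd1.trans hd2.symm) hm1.ne_zero
      rw [hm1.leadingCoeff, hm2.leadingCoeff]
    · intro e he
      rw [Polynomial.eval_prod, Finset.prod_eq_zero he (by simp)]
      have := (Finset.mem_filter.mp he).2
      simp [this]
  have := congrArg (Polynomial.eval x) key
  rw [Polynomial.eval_prod] at this
  simpa [CharTwo.sub_eq_add] using this

/-- Reduction Lemma: let `q` be a power of 2, `ℓ` even, and `ℓ/2 + 1 ≤ m ≤ ℓ`. If there is
an `F_q`-subspace `U` of the subfield `F_{q^{ℓ/2}} = {x : x^{q^{ℓ/2}} = x}` of `F_{q^ℓ}`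
of dimension `m − ℓ/2` with `τ_U ∈ F_q`, then there is an `m`-dimensional `F_q`-subspace
`W` of `F_{q^ℓ}` with `τ_W ∈ F_q` and `L_W(L_W(α)) = 0` for all `α`. -/
theorem statement10 {K F : Type*} [Field K] [Field F] [Fintype K] [Fintype F] [Algebra K F]
    (q ℓ m : ℕ) (hq : Fintype.card K = q) (hq2 : ∃ s : ℕ, 1 ≤ s ∧ q = 2 ^ s)
    (hℓ : Module.finrank K F = ℓ) (hℓeven : 2 ∣ ℓ)
    (hm1 : ℓ / 2 + 1 ≤ m) (hmℓ : m ≤ ℓ)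
    (U : Submodule K F) (hUsub : ∀ x ∈ U, x ^ q ^ (ℓ / 2) = x)
    (hUdim : Module.finrank K U = m - ℓ / 2)
    (hτU : (∏ u ∈ Finset.univ.filter (fun u : F => u ∈ U ∧ u ≠ 0), u) ∈
      Set.range (algebraMap K F)) :
    ∃ W : Submodule K F, Module.finrank K W = m ∧
      (∏ w ∈ Finset.univ.filter (fun w : F => w ∈ W ∧ w ≠ 0), w) ∈
        Set.range (algebraMap K F) ∧
      ∀ α : F,
        (∏ w ∈ Finset.univ.filter (fun w : F => w ∈ W),
          ((∏ w' ∈ Finset.univ.filter (fun w' : F => w' ∈ W), (α - w')) - w)) = 0 := by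
  obtain ⟨s, hs, hqs⟩ := hq2
  obtain ⟨n, hn⟩ := hℓeven
  have hn2 : ℓ / 2 = n := by omega
  rw [hn2] at hm1 hUsub hUdim
  have hnpos : 1 ≤ n := by omega
  have hKchar : CharP K 2 := by
    obtain ⟨p, hp⟩ := CharP.exists K
    have hpp : p.Prime := CharP.char_is_prime K p
    obtain ⟨k, _, hk⟩ := FiniteField.card K p
    rw [hq, hqs] at hk
    have : p ∣ 2 ^ s := by rw [hk]; exact dvd_pow_self _ k.pos.ne'
    have := (Nat.prime_dvd_prime_iff_eq hpp Nat.prime_two).mp (hpp.dvd_of_dvd_pow this)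
    rwa [this] at hp
  have hF2 : CharP F 2 := charP_of_injective_algebraMap (algebraMap K F).injective 2
  let σ : F →ₐ[K] F := (FiniteField.frobeniusAlgHom K F) ^ n
  have hσ : ∀ x, σ x = x ^ q ^ n := by
    intro x
    have : ∀ k : ℕ, ((FiniteField.frobeniusAlgHom K F) ^ k) x = x ^ q ^ k := by
      intro k
      induction k with
      | zero => simp
      | succ k ih =>
        rw [pow_succ', AlgHom.mul_apply, ih, FiniteField.coe_frobeniusAlgHom]
        simp only [hq]
        rw [← pow_mul, pow_succ]
    exact this n
  have hq1 : 2 ≤ q := by rw [hqs]; exact Nat.le_self_pow (by omega) 2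
  set N := q ^ n with hN
  have hN2 : 2 ≤ N := hq1.trans (Nat.le_self_pow (by omega) q)
  have hcardF : Fintype.card F = N * N := by
    rw [Module.card_eq_pow_finrank (K := K) (V := F), hq, hℓ, hn, hN, ← pow_add, two_mul]
  have hσσ : ∀ x, σ (σ x) = x := by
    intro x
    rw [hσ, hσ, ← pow_mul, ← hcardF, FiniteField.pow_card]
  let T : F →ₗ[K] F := σ.toLinearMap + LinearMap.id
  have hT : ∀ x, T x = σ x + x := fun x => rfl
  have hTT : ∀ x, T (T x) = 0 := by
    intro x
    rw [hT, hT, map_add, hσσ, add_comm x, CharTwo.add_self_eq_zero]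
  have hle : LinearMap.range T ≤ LinearMap.ker T := by
    rintro _ ⟨x, rfl⟩
    exact hTT x
  have hrn := LinearMap.finrank_range_add_finrank_ker T
  rw [hℓ, hn] at hrn
  have hle' := Submodule.finrank_mono hle
  have hkercard : (Finset.univ.filter (fun e : F => e ^ N + e = 0)).card
      = q ^ Module.finrank K (LinearMap.ker T) := by
    rw [← hq, ← Module.card_eq_pow_finrank (K := K) (V := LinearMap.ker T), Fintype.card_subtype]
    congr 1
    ext e
    simp [hT, hσ]
  have hker_le : Module.finrank K (LinearMap.ker T) ≤ n := by
    rw [← Nat.pow_le_pow_iff_right (show 1 < q by omega), ← hkercard, ← hN]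
    have hlt : (Polynomial.X : Polynomial F).degree < (N : WithBot ℕ) := by
      rw [Polynomial.degree_X]; exact_mod_cast hN2
    have hne : (Polynomial.X ^ N + Polynomial.X : Polynomial F) ≠ 0 :=
      (Polynomial.monic_X_pow_add hlt).ne_zero
    have hd2 : (Polynomial.X ^ N + Polynomial.X : Polynomial F).natDegree = N := by
      apply Polynomial.natDegree_eq_of_degree_eq_some
      rw [Polynomial.degree_add_eq_left_of_degree_lt] <;> rw [Polynomial.degree_X_pow]
      exact hlt
    conv_rhs => rw [← hd2]
    apply Polynomial.card_le_degree_of_subset_roots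
    intro e he
    have he' : e ^ N + e = 0 := by simpa using he
    rw [Polynomial.mem_roots hne]
    simp [he']
  have hker : Module.finrank K (LinearMap.ker T) = n := by omega
  rw [hker] at hkercard
  have hrk : LinearMap.range T = LinearMap.ker T :=
    Submodule.eq_of_le_of_finrank_eq hle (by omega)
  have hUker : U ≤ LinearMap.ker T := by
    intro x hx
    rw [LinearMap.mem_ker, hT, hσ, hUsub x hx, CharTwo.add_self_eq_zero]
  have hkerW : LinearMap.ker T ≤ U.comap T := by
    intro x hx
    rw [Submodule.mem_comap, LinearMap.mem_ker.mp hx]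
    exact U.zero_mem
  refine ⟨U.comap T, ?_, ?_, ?_⟩
  · have h := LinearMap.finrank_range_add_finrank_ker (T.domRestrict (U.comap T))
    have h1 : LinearMap.range (T.domRestrict (U.comap T)) = U := by
      rw [LinearMap.range_domRestrict, Submodule.map_comap_eq, hrk]
      exact inf_eq_right.mpr hUker
    have h2 : Module.finrank K (LinearMap.ker (T.domRestrict (U.comap T))) = n := by
      rw [LinearMap.ker_domRestrict, ← hker]
      exact (Submodule.comapSubtypeEquivOfLe hkerW).finrank_eq
    rw [h1, h2, hUdim] at h
    omega
  · have hmaps : ∀ w ∈ Finset.univ.filter (fun w : F => w ∈ U.comap T ∧ w ≠ 0),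
        T w ∈ Finset.univ.filter (fun u : F => u ∈ U) := by
      intro w hw
      simpa using (Finset.mem_filter.mp hw).2.1
    rw [← Finset.prod_fiberwise_of_maps_to hmaps]
    have h0 : (0 : F) ∈ Finset.univ.filter (fun u : F => u ∈ U) := by simp
    rw [← Finset.mul_prod_erase _ _ h0]
    have hone : ∏ w ∈ (Finset.univ.filter (fun w : F => w ∈ U.comap T ∧ w ≠ 0)).filter
        (fun w => T w = 0), w = 1 := by
      refine Finset.prod_involution (fun a _ => a⁻¹) ?_ ?_ ?_ ?_
      · intro a ha
        simp only [Finset.mem_filter] at ha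
        exact mul_inv_cancel₀ ha.1.2.2
      · intro a ha hne heq
        simp only [Finset.mem_filter] at ha
        have h1 : a * a = 1 := by
          nth_rewrite 2 [← heq]
          exact mul_inv_cancel₀ ha.1.2.2
        apply hne
        have h2 : (a + 1) * (a + 1) = 0 := by
          rw [CharTwo.add_mul_self, h1, one_mul, CharTwo.add_self_eq_zero]
        exact CharTwo.add_eq_zero.mp (mul_self_eq_zero.mp h2)
      · intro a ha
        simp only [Finset.mem_filter, Finset.mem_univ, true_and] at ha ⊢
        have h1 : σ a = a := CharTwo.add_eq_zero.mp ((hT a).symm.trans ha.2)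
        have h2 : T a⁻¹ = 0 := by
          rw [hT, map_inv₀, h1, CharTwo.add_self_eq_zero]
        exact ⟨⟨hkerW (LinearMap.mem_ker.mpr h2), inv_ne_zero ha.1.2⟩, h2⟩
      · intro a ha
        exact inv_inv a
    rw [hone, one_mul]
    have heq : (Finset.univ.filter (fun u : F => u ∈ U)).erase 0
        = Finset.univ.filter (fun u : F => u ∈ U ∧ u ≠ 0) := by
      ext u; simp [and_comm]
    rw [heq]
    convert hτU using 1
    refine Finset.prod_congr rfl ?_
    intro u hu
    simp only [Finset.mem_filter, Finset.mem_univ, true_and] at hu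
    have hur : u ∈ LinearMap.range T := hrk ▸ hUker hu.1
    obtain ⟨x, hx⟩ := hur
    have hp := aux_prod N hN2 hkercard x
    rw [← hσ, ← hT, hx] at hp
    refine Eq.trans ?_ hp
    symm
    refine Finset.prod_bij (fun e _ => x + e) ?_ ?_ ?_ ?_
    · intro e he
      simp only [Finset.mem_filter, Finset.mem_univ, true_and] at he ⊢
      rw [← hσ, ← hT] at he
      have h3 : T (x + e) = u := by rw [map_add, he, hx, add_zero]
      refine ⟨⟨?_, ?_⟩, h3⟩
      · rw [Submodule.mem_comap, h3]; exact hu.1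
      · intro h4
        rw [h4, map_zero] at h3
        exact hu.2 h3.symm
    · intro a _ b _ hab
      exact add_left_cancel hab
    · intro w hw
      simp only [Finset.mem_filter, Finset.mem_univ, true_and] at hw
      refine ⟨w - x, ?_, by ring⟩
      simp only [Finset.mem_filter, Finset.mem_univ, true_and]
      rw [← hσ, ← hT, map_sub, hw.2, hx, sub_self]
    · intro e _
      rfl
  · intro α
    set S := Finset.univ.filter (fun w : F => w ∈ U.comap T) with hS
    have hσT : ∀ x, σ x = x + T x := by
      intro x
      rw [hT, add_comm (σ x), ← add_assoc, CharTwo.add_self_eq_zero, zero_add]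
    have hmem : ∀ x, x ∈ S ↔ x ∈ U.comap T := by intro x; simp [hS]
    have hWσ : ∀ x ∈ S, σ x ∈ S := by
      intro x hx
      rw [hmem] at hx ⊢
      rw [hσT]
      exact add_mem hx (hkerW (hUker hx))
    have hTα : T α ∈ U.comap T := hkerW (LinearMap.mem_ker.mpr (hTT α))
    have hfix : σ (∏ w' ∈ S, (α - w')) = ∏ w' ∈ S, (α - w') := by
      rw [map_prod]
      refine Finset.prod_bij (fun w _ => σ w - T α) ?_ ?_ ?_ ?_
      · intro w hw
        rw [hmem]
        exact sub_mem ((hmem _).mp (hWσ w hw)) hTα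
      · intro a _ b _ hab
        exact σ.toRingHom.injective (sub_left_injective hab)
      · intro w hw
        refine ⟨σ (w + T α), hWσ _ ?_, ?_⟩
        · rw [hmem] at hw ⊢
          exact add_mem hw hTα
        · simp only [hσσ]; ring
      · intro w hw
        rw [map_sub, hσT α]; ring
    apply Finset.prod_eq_zero (i := ∏ w' ∈ S, (α - w'))
    · rw [hmem]
      apply hkerW
      rw [LinearMap.mem_ker, hT, hfix, CharTwo.add_self_eq_zero]
    · exact sub_self _
end

section
/- Let q be a prime power and a ≥ b ≥ 1 integers. Set ℓ = q^a, m = q^b − 1, and assume m > 1. Let t = ℓ mod m. Define σ : F_{q^ℓ} → F_{q^ℓ} by σ(x) = ∑_{i=0}^{m} x^{q^i}. Then the ⌈(ℓ − m)/m⌉-fold iterate of σ equals the map x ↦ ∑_{j=0}^{ℓ/t − 1} x^{q^{tj}}, i.e., the trace map from F_{q^ℓ} to its subfield F_{q^t}. -/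
open scoped Classical

open Polynomial in
lemma geom_aux {K : Type*} [Field K] (p : ℕ) [Fact p.Prime] [CharP K p] (n : ℕ) :
    (X - 1 : K[X]) ^ p ^ n = X ^ p ^ n - 1 := by
  rw [sub_pow_char_pow, one_pow]

open Polynomial in
lemma geom_aux2 {K : Type*} [Field K] (p : ℕ) [Fact p.Prime] [CharP K p] (n k : ℕ)
    (h : n ≤ k) :
    ∑ j ∈ Finset.range (p ^ k / p ^ n), (X : K[X]) ^ (p ^ n * j) = (X - 1) ^ (p ^ k - p ^ n) := by
  have hp : 0 < p := (Fact.out : p.Prime).pos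
  have hX : (X - 1 : K[X]) ≠ 0 := by
    simpa using Polynomial.X_sub_C_ne_zero (1 : K)
  apply mul_right_cancel₀ (pow_ne_zero (p ^ n) hX)
  rw [← pow_add, Nat.sub_add_cancel (Nat.pow_le_pow_right hp h), geom_aux, geom_aux]
  simp_rw [pow_mul]
  rw [geom_sum_mul, ← pow_mul, Nat.mul_div_cancel' (pow_dvd_pow p h)]

lemma mod_aux (q a b : ℕ) (hq : 2 ≤ q) (hb : 1 ≤ b) (hm1 : 1 < q ^ b - 1) :
    q ^ a % (q ^ b - 1) = q ^ (a % b) := by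
  have h1 : q ^ b ≡ 1 [MOD (q ^ b - 1)] :=
    ((Nat.modEq_iff_dvd' (by omega)).2 dvd_rfl).symm
  have h2 : q ^ a ≡ q ^ (a % b) [MOD (q ^ b - 1)] := by
    conv_lhs => rw [← Nat.div_add_mod a b, pow_add, pow_mul]
    simpa using (h1.pow (a / b)).mul_right (q ^ (a % b))
  have h3 : q ^ (a % b) ≤ q ^ (b - 1) :=
    Nat.pow_le_pow_right (by omega) (by have := Nat.mod_lt a hb; omega)
  have h4 : q ^ b = q ^ (b - 1) * q := by rw [← pow_succ]; congr 1; omega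
  have h5 : q ^ (b - 1) * 2 ≤ q ^ (b - 1) * q := Nat.mul_le_mul_left _ hq
  exact Eq.trans h2 (Nat.mod_eq_of_lt (by omega))

/-- With `ℓ = q^a`, `m = q^b − 1 > 1` (`a ≥ b ≥ 1`) and `t = ℓ mod m`, the
`⌈(ℓ − m)/m⌉`-fold iterate of `σ(x) = ∑_{i=0}^{m} x^{q^i}` on `F_{q^ℓ}` equals the map
`x ↦ ∑_{j=0}^{ℓ/t − 1} x^{q^{tj}}`, i.e. the trace map from `F_{q^ℓ}` to `F_{q^t}`. -/
theorem statement14 {K F : Type*} [Field K] [Field F] [Fintype K] [Fintype F] [Algebra K F]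
    (q a b ℓ m t : ℕ) (hq : Fintype.card K = q) (hab : b ≤ a) (hb : 1 ≤ b)
    (hℓ : ℓ = q ^ a) (hm : m = q ^ b - 1) (hm1 : 1 < m) (ht : t = ℓ % m)
    (hdim : Module.finrank K F = ℓ) :
    (fun x : F => ∑ i ∈ Finset.range (m + 1), x ^ q ^ i)^[(ℓ - m + m - 1) / m] =
      fun x : F => ∑ j ∈ Finset.range (ℓ / t), x ^ q ^ (t * j) := by
  have hq2 : 2 ≤ q := hq ▸ Fintype.one_lt_card (α := K)
  have hta : t = q ^ (a % b) := by rw [ht, hℓ, hm]; exact mod_aux q a b hq2 hb (hm ▸ hm1)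
  have htm : t < m := ht ▸ Nat.mod_lt _ (by omega)
  have ht1 : 1 ≤ t := hta ▸ Nat.one_le_pow _ _ (by omega)
  have hml : m + 1 ≤ ℓ := by
    have := Nat.pow_le_pow_right (by omega : 0 < q) hab
    omega
  have hdm := Nat.div_add_mod ℓ m
  rw [← ht] at hdm
  have hN : (ℓ - m + m - 1) / m = ℓ / m := by
    apply Nat.div_eq_of_lt_le
    · rw [mul_comm]; omega
    · rw [Nat.succ_mul, mul_comm]; omega
  have hNm : m * (ℓ / m) = ℓ - t := by omega
  obtain ⟨p, hp⟩ := CharP.exists K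
  obtain ⟨n, hpp, hcard⟩ := FiniteField.card K p
  haveI : Fact p.Prime := ⟨hpp⟩
  have hqp : q = p ^ (n : ℕ) := hq ▸ hcard
  let φ : Module.End K F := (FiniteField.frobeniusAlgHom K F).toLinearMap
  have hφ : ∀ (i : ℕ) (x : F), (φ ^ i) x = x ^ q ^ i := by
    intro i
    induction i with
    | zero => intro x; simp
    | succ i ih =>
      intro x
      rw [pow_succ', Module.End.mul_apply, ih]
      change (x ^ q ^ i) ^ Fintype.card K = _
      rw [hq, ← pow_mul, ← pow_succ]
  have hS : ∑ i ∈ Finset.range (m + 1), (Polynomial.X : Polynomial K) ^ i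
      = (Polynomial.X - 1) ^ m := by
    have := geom_aux2 (K := K) p 0 (n * b) (Nat.zero_le _)
    rw [pow_mul, ← hqp] at this
    have e : q ^ b = m + 1 := by omega
    simpa [e] using this
  have hT : ∑ j ∈ Finset.range (ℓ / t), (Polynomial.X : Polynomial K) ^ (t * j)
      = (Polynomial.X - 1) ^ (ℓ - t) := by
    have := geom_aux2 (K := K) p (n * (a % b)) (n * a)
      (Nat.mul_le_mul_left _ (Nat.mod_le a b))
    rwa [pow_mul, pow_mul, ← hqp, ← hℓ, ← hta] at this
  have hσ : (fun x : F => ∑ i ∈ Finset.range (m + 1), x ^ q ^ i)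
      = ⇑(Polynomial.aeval φ ((Polynomial.X - 1 : Polynomial K) ^ m)) := by
    funext x
    rw [← hS]
    simp [LinearMap.sum_apply, hφ]
  have hτ : (fun x : F => ∑ j ∈ Finset.range (ℓ / t), x ^ q ^ (t * j))
      = ⇑(Polynomial.aeval φ ((Polynomial.X - 1 : Polynomial K) ^ (ℓ - t))) := by
    funext x
    rw [← hT]
    simp [LinearMap.sum_apply, hφ]
  rw [hσ, hτ, hN, ← Module.End.coe_pow, ← map_pow, ← pow_mul, hNm]
end
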